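/- (Behavior of ψ at infinity) Assume (W) in dimension N = 1 with g ≡ 1/π, and let φ be the solution of I1[φ] = W'(φ) with φ(−∞) = 0, φ(+∞) = 1, φ(0) = 1/2, φ' > 0. For L ∈ ℝ, let ψ be the solution of I1[ψ] = W''(φ)ψ + (L/α)(W''(φ) − W''(0)) + cφ' on ℝ with ψ(±∞) = 0 and c = L/∫_ℝ(φ')². Then there exist constants K2 ∈ ℝ and K3 > 0, depending on L, such that |ψ(x) − K2/x| ≤ K3/x² for |x| ≥ 1, and for every x ∈ ℝ: −K3/(1+x²) ≤ ψ'(x) ≤ K3/(1+x²) and −K3/(1+x²) ≤ ψ''(x) ≤ K3/(1+x²). -/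

import Mathlib

open MeasureTheory Set Filter Topology Metric

noncomputable section

/-- `I1^{1,r}[U,x]` in dimension one with `g ≡ 1/π` (half-Laplacian). -/
def J1 (r : ℝ) (U : ℝ → ℝ) (x : ℝ) : ℝ :=
  ∫ z in {z : ℝ | |z| ≤ r}, (U (x + z) - U x - deriv U x * z) / (Real.pi * z ^ 2)

/-- `I1^{2,r}[U,x]` in dimension one with `g ≡ 1/π`. -/
def J2 (r : ℝ) (U : ℝ → ℝ) (x : ℝ) : ℝ :=
  ∫ z in {z : ℝ | r < |z|}, (U (x + z) - U x) / (Real.pi * z ^ 2)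

/-- The one-dimensional operator `I1 = -(-Δ)^{1/2}`. -/
def halfLap (U : ℝ → ℝ) (x : ℝ) : ℝ := J1 1 U x + J2 1 U x

/-- Assumption (W): `W ∈ C^{4,β}`, 1-periodic, vanishing exactly on ℤ, with `W''(0) > 0`. -/
def AssumptionW (W : ℝ → ℝ) : Prop :=
  (∃ β ∈ Ioo (0:ℝ) 1, ContDiff ℝ 4 W ∧
    ∃ Kβ : ℝ, ∀ a b : ℝ, |iteratedDeriv 4 W a - iteratedDeriv 4 W b| ≤ Kβ * |a - b| ^ β) ∧
  (∀ v : ℝ, W (v + 1) = W v) ∧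
  (∀ k : ℤ, W (k : ℝ) = 0) ∧
  (∀ v : ℝ, (∀ k : ℤ, v ≠ (k : ℝ)) → 0 < W v) ∧
  0 < deriv (deriv W) 0

/-- The phase transition `φ`: solution of `I1[φ] = W'(φ)`, `φ(−∞)=0`, `φ(+∞)=1`,
`φ(0)=1/2`, `φ' > 0` (it is of class `C^{4,β}`, with bounded derivatives). -/
def IsPhi (W φ : ℝ → ℝ) : Prop :=
  ContDiff ℝ 4 φ ∧
  (∀ x : ℝ, halfLap φ x = deriv W (φ x)) ∧
  Tendsto φ atBot (𝓝 0) ∧ Tendsto φ atTop (𝓝 1) ∧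
  φ 0 = 1 / 2 ∧ (∀ x : ℝ, 0 < deriv φ x)

/-- The corrector `ψ`: solution of
`I1[ψ] = W''(φ)ψ + (L/α)(W''(φ) − W''(0)) + cφ'` with `ψ(±∞) = 0` and
`c = L/∫_ℝ(φ')²` (it is of class `C^{3,β}` with bounded derivatives). -/
def IsPsi (W φ : ℝ → ℝ) (L : ℝ) (ψ : ℝ → ℝ) : Prop :=
  ContDiff ℝ 3 ψ ∧
  (∀ x : ℝ, halfLap ψ x =
    deriv (deriv W) (φ x) * ψ x +
    L / deriv (deriv W) 0 * (deriv (deriv W) (φ x) - deriv (deriv W) 0) +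
    L / (∫ y : ℝ, (deriv φ y) ^ 2) * deriv φ x) ∧
  Tendsto ψ atBot (𝓝 0) ∧ Tendsto ψ atTop (𝓝 0)

/-- First-order Taylor bound on a compact interval. -/
lemma exists_taylor_bound {u : ℝ → ℝ} (hu : ContDiff ℝ 2 u) (a b : ℝ) :
    ∃ C, ∀ x ∈ Icc a b, ∀ y ∈ Icc a b, |u y - u x - deriv u x * (y - x)| ≤ C * (y - x) ^ 2 := by
  have hu' : ContDiff ℝ 1 (deriv u) := ContDiff.deriv' hu
  have hu'' : Continuous (deriv (deriv u)) := hu'.continuous_deriv le_rfl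
  obtain ⟨C, hC⟩ := isCompact_Icc.exists_bound_of_continuousOn (s := Icc a b) hu''.continuousOn
  refine ⟨C, fun x hx y hy => ?_⟩
  have hsub : uIcc x y ⊆ Icc a b := uIcc_subset_Icc hx hy
  have hC0 : 0 ≤ C := (norm_nonneg _).trans (hC x hx)
  have hd1 : ∀ t, HasDerivAt u (deriv u t) t := fun t =>
    ((hu.differentiable (by norm_num)) t).hasDerivAt
  have hd2 : ∀ t, HasDerivAt (deriv u) (deriv (deriv u) t) t := fun t =>
    ((hu'.differentiable (by norm_num)) t).hasDerivAt
  have h1 : ∀ t ∈ uIcc x y, ‖deriv u t - deriv u x‖ ≤ C * |y - x| := by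
    intro t ht
    have := Convex.norm_image_sub_le_of_norm_hasDerivWithin_le (s := uIcc x y)
      (fun s _ => (hd2 s).hasDerivWithinAt) (fun s hs => hC s (hsub hs)) (convex_uIcc x y)
      left_mem_uIcc ht
    refine this.trans (mul_le_mul_of_nonneg_left ?_ hC0)
    exact abs_sub_left_of_mem_uIcc ht
  have h2 := Convex.norm_image_sub_le_of_norm_hasDerivWithin_le (s := uIcc x y)
      (f := fun t => u t - deriv u x * t) (f' := fun t => deriv u t - deriv u x)
      (fun s _ => by
        simpa using ((hd1 s).fun_sub ((hasDerivAt_id' s).const_mul (deriv u x))).hasDerivWithinAt)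
      h1 (convex_uIcc x y) left_mem_uIcc right_mem_uIcc
  rw [Real.norm_eq_abs, Real.norm_eq_abs, mul_assoc, ← sq, sq_abs] at h2
  convert h2 using 2
  ring

lemma setOf_abs_le_one : {z : ℝ | |z| ≤ 1} = Icc (-1) 1 := by
  ext z; simp [abs_le]

lemma measurableSet_one_lt_abs : MeasurableSet {z : ℝ | 1 < |z|} :=
  measurableSet_lt measurable_const continuous_abs.measurable

lemma integrableOn_tail_bound (M : ℝ) :
    IntegrableOn (fun z : ℝ => M / (Real.pi * z ^ 2)) {z : ℝ | 1 < |z|} := by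
  have h : Integrable (fun z : ℝ => (2 * |M| / Real.pi) * (1 + z ^ 2)⁻¹) :=
    integrable_inv_one_add_sq.const_mul _
  refine h.integrableOn.mono' ?_ ?_
  · exact (Measurable.aestronglyMeasurable (by fun_prop))
  · refine (ae_restrict_iff' measurableSet_one_lt_abs).2 (ae_of_all _ fun z hz => ?_)
    have hz1 : 1 < z ^ 2 := by
      have : 1 < |z| := hz
      rw [← sq_abs]; nlinarith
    have hp := Real.pi_pos
    rw [Real.norm_eq_abs, abs_div, abs_of_pos (by positivity : 0 < Real.pi * z ^ 2),
      ← div_eq_mul_inv, div_div, div_le_div_iff₀ (by positivity) (by positivity)]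
    have : 0 ≤ |M| * Real.pi := by positivity
    nlinarith

lemma integrableOn_J1 {u : ℝ → ℝ} (hu : ContDiff ℝ 2 u) (x : ℝ) :
    IntegrableOn (fun z => (u (x + z) - u x - deriv u x * z) / (Real.pi * z ^ 2))
      {z : ℝ | |z| ≤ 1} := by
  obtain ⟨C, hC⟩ := exists_taylor_bound hu (x - 1) (x + 1)
  have hc := hu.continuous
  have hp := Real.pi_pos
  refine Measure.integrableOn_of_bounded (M := |C| / Real.pi) ?_ ?_ ?_
  · rw [setOf_abs_le_one]; simp
  · exact (Measurable.aestronglyMeasurable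
      (by have := hc.measurable; fun_prop))
  · rw [setOf_abs_le_one]
    refine (ae_restrict_iff' measurableSet_Icc).2 (ae_of_all _ fun z hz => ?_)
    have h := hC x ⟨by linarith, by linarith⟩ (x + z) ⟨by linarith [hz.1], by linarith [hz.2]⟩
    rw [add_sub_cancel_left] at h
    rcases eq_or_ne z 0 with rfl | hz0
    · simp; positivity
    · have hz2 : 0 < z ^ 2 := by positivity
      rw [Real.norm_eq_abs, abs_div, abs_of_pos (by positivity : 0 < Real.pi * z ^ 2),
        div_le_div_iff₀ (by positivity) hp]
      have : C * z ^ 2 ≤ |C| * z ^ 2 := mul_le_mul_of_nonneg_right (le_abs_self C) hz2.le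
      nlinarith

lemma integrableOn_J2 {u : ℝ → ℝ} (hu : Continuous u) {M : ℝ} (hM : ∀ x, |u x| ≤ M) (x : ℝ) :
    IntegrableOn (fun z => (u (x + z) - u x) / (Real.pi * z ^ 2)) {z : ℝ | 1 < |z|} := by
  refine (integrableOn_tail_bound (2 * M)).mono' ?_ (ae_of_all _ fun z => ?_)
  · exact (Measurable.aestronglyMeasurable (by have := hu.measurable; fun_prop))
  · have hp := Real.pi_pos
    rw [Real.norm_eq_abs, abs_div, abs_of_nonneg (by positivity : 0 ≤ Real.pi * z ^ 2)]
    refine div_le_div_of_nonneg_right ?_ (by positivity)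
    calc |u (x + z) - u x| ≤ |u (x + z)| + |u x| := abs_sub _ _
      _ ≤ 2 * M := by linarith [hM x, hM (x + z)]

/-- Bounded functions of class `C²`, on which `halfLap` is given by convergent integrals. -/
def BddC2 (u : ℝ → ℝ) : Prop := ContDiff ℝ 2 u ∧ ∃ M, ∀ x, |u x| ≤ M

lemma BddC2.differentiable {u : ℝ → ℝ} (hu : BddC2 u) : Differentiable ℝ u :=
  hu.1.differentiable (by norm_num)

lemma BddC2.add {u v : ℝ → ℝ} (hu : BddC2 u) (hv : BddC2 v) : BddC2 (fun x => u x + v x) := by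
  obtain ⟨hu, M, hM⟩ := hu
  obtain ⟨hv, N, hN⟩ := hv
  exact ⟨hu.add hv, M + N, fun x => (abs_add_le _ _).trans (add_le_add (hM x) (hN x))⟩

lemma BddC2.const_mul {u : ℝ → ℝ} (hu : BddC2 u) (c : ℝ) : BddC2 (fun x => c * u x) := by
  obtain ⟨hu, M, hM⟩ := hu
  exact ⟨contDiff_const.mul hu, |c| * M, fun x => by
    rw [abs_mul]; exact mul_le_mul_of_nonneg_left (hM x) (abs_nonneg c)⟩

lemma BddC2.sub {u v : ℝ → ℝ} (hu : BddC2 u) (hv : BddC2 v) : BddC2 (fun x => u x - v x) := by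
  have := hu.add (hv.const_mul (-1))
  simpa [sub_eq_add_neg] using this

lemma BddC2.comp_add_const {u : ℝ → ℝ} (hu : BddC2 u) (h : ℝ) : BddC2 (fun x => u (x + h)) := by
  obtain ⟨hu, M, hM⟩ := hu
  exact ⟨hu.comp (contDiff_id.add contDiff_const), M, fun x => hM _⟩

lemma halfLap_add {u v : ℝ → ℝ} (hu : BddC2 u) (hv : BddC2 v) (x : ℝ) :
    halfLap (fun x => u x + v x) x = halfLap u x + halfLap v x := by
  obtain ⟨M, hM⟩ := hu.2
  obtain ⟨N, hN⟩ := hv.2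
  have h1 : J1 1 (fun x => u x + v x) x = J1 1 u x + J1 1 v x := by
    unfold J1
    rw [← integral_add (integrableOn_J1 hu.1 x) (integrableOn_J1 hv.1 x)]
    congr 1; ext z
    rw [deriv_fun_add (hu.differentiable x) (hv.differentiable x)]
    ring
  have h2 : J2 1 (fun x => u x + v x) x = J2 1 u x + J2 1 v x := by
    unfold J2
    rw [← integral_add (integrableOn_J2 hu.1.continuous hM x)
      (integrableOn_J2 hv.1.continuous hN x)]
    congr 1; ext z
    ring
  unfold halfLap
  rw [h1, h2]; ring

lemma halfLap_const_mul {u : ℝ → ℝ} (hu : BddC2 u) (c : ℝ) (x : ℝ) :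
    halfLap (fun x => c * u x) x = c * halfLap u x := by
  unfold halfLap J1 J2
  rw [mul_add, ← integral_const_mul, ← integral_const_mul, deriv_const_mul c (hu.differentiable x)]
  congr 2 <;> ext z <;> ring

lemma halfLap_sub {u v : ℝ → ℝ} (hu : BddC2 u) (hv : BddC2 v) (x : ℝ) :
    halfLap (fun x => u x - v x) x = halfLap u x - halfLap v x := by
  have h := halfLap_add hu (hv.const_mul (-1)) x
  rw [halfLap_const_mul hv] at h
  simpa [sub_eq_add_neg] using h

lemma halfLap_comp_add_const (u : ℝ → ℝ) (h x : ℝ) :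
    halfLap (fun x => u (x + h)) x = halfLap u (x + h) := by
  unfold halfLap J1 J2
  simp only [deriv_comp_add_const, add_right_comm x _ h]

lemma halfLap_nonpos_of_max {u : ℝ → ℝ} {x : ℝ} (h : ∀ y, u y ≤ u x) : halfLap u x ≤ 0 := by
  have hd : deriv u x = 0 := IsLocalMax.deriv_eq_zero (Eventually.of_forall h)
  have hp := Real.pi_pos
  have h1 : J1 1 u x ≤ 0 := integral_nonpos fun z => by
    have := h (x + z)
    exact div_nonpos_of_nonpos_of_nonneg (by rw [hd]; simpa using this) (by positivity)
  have h2 : J2 1 u x ≤ 0 := integral_nonpos fun z => by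
    have := h (x + z)
    exact div_nonpos_of_nonpos_of_nonneg (by simpa using this) (by positivity)
  exact add_nonpos h1 h2

/-- Evaluation of `halfLap` from a regularised primitive of the singular integrand. -/
lemma halfLap_eq_of_primitive {U T : ℝ → ℝ} (hU : BddC2 U) {x a b : ℝ} (hT : Continuous T)
    (hd : ∀ z ≠ 0, HasDerivAt T ((U (x + z) - U x - deriv U x * z) / z ^ 2) z)
    (ha : Tendsto (fun z => T z + deriv U x * Real.log z) atBot (𝓝 a))
    (hb : Tendsto (fun z => T z + deriv U x * Real.log z) atTop (𝓝 b)) :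
    halfLap U x = (b - a) / Real.pi := by
  obtain ⟨M, hM⟩ := hU.2
  have hp := Real.pi_pos
  have hdL : ∀ z ≠ 0, HasDerivAt (fun z => (T z + deriv U x * Real.log z) / Real.pi)
      ((U (x + z) - U x) / (Real.pi * z ^ 2)) z := by
    intro z hz
    refine (((hd z hz).add ((Real.hasDerivAt_log hz).const_mul (deriv U x))).div_const
      Real.pi).congr_deriv ?_
    field_simp
    ring
  have h1 : J1 1 U x = T 1 / Real.pi - T (-1) / Real.pi := by
    have hi := integrableOn_J1 hU.1 x
    unfold J1
    rw [setOf_abs_le_one] at hi ⊢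
    rw [integral_Icc_eq_integral_Ioc, ← intervalIntegral.integral_of_le (by norm_num)]
    refine integral_eq_of_hasDerivAt_off_countable (fun z => T z / Real.pi) _ (s := {0})
      (countable_singleton 0) (hT.div_const _).continuousOn ?_ ?_
    · intro z hz
      refine ((hd z (by simpa using hz.2)).div_const Real.pi).congr_deriv ?_
      rw [div_div, mul_comm (z ^ 2)]
    · rw [intervalIntegrable_iff_integrableOn_Icc_of_le (by norm_num)]
      exact hi
  have hset : {z : ℝ | 1 < |z|} = Iio (-1) ∪ Ioi 1 := by
    ext z
    simp only [mem_ofPred_eq, lt_abs, mem_union, mem_Iio, mem_Ioi]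
    constructor
    · rintro (h | h)
      · exact Or.inr h
      · exact Or.inl (by linarith)
    · rintro (h | h)
      · exact Or.inr (by linarith)
      · exact Or.inl h
  have h2 : J2 1 U x = (T (-1) / Real.pi - a / Real.pi) + (b / Real.pi - T 1 / Real.pi) := by
    have hi := integrableOn_J2 hU.1.continuous hM x
    unfold J2
    rw [hset] at hi ⊢
    rw [setIntegral_union ?_ measurableSet_Ioi (hi.mono_set subset_union_left)
      (hi.mono_set subset_union_right), ← integral_Iic_eq_integral_Iio,
      integral_Iic_of_hasDerivAt_of_tendsto
        (f := fun z => (T z + deriv U x * Real.log z) / Real.pi) ?_ ?_ ?_ (ha.div_const _),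
      integral_Ioi_of_hasDerivAt_of_tendsto
        (f := fun z => (T z + deriv U x * Real.log z) / Real.pi) ?_ ?_ ?_ (hb.div_const _)]
    · simp
    · exact (hdL 1 one_ne_zero).continuousAt.continuousWithinAt
    · intro z hz
      exact hdL z (by have : (1:ℝ) < z := hz; intro h; linarith)
    · exact hi.mono_set subset_union_right
    · exact (hdL (-1) (by norm_num)).continuousAt.continuousWithinAt
    · intro z hz
      exact hdL z (by have : z < (-1:ℝ) := hz; intro h; linarith)
    · rw [integrableOn_Iic_iff_integrableOn_Iio]
      exact hi.mono_set subset_union_left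
    · rw [Set.disjoint_left]
      intro z hz hz'
      have h3 : z < (-1:ℝ) := hz
      have h4 : (1:ℝ) < z := hz'
      linarith
  unfold halfLap
  rw [h1, h2]
  ring

/-- Differentiation of `halfLap u` under the integral sign. -/
lemma hasDerivAt_halfLap {u : ℝ → ℝ} (hu : ContDiff ℝ 3 u) (hb : ∃ M, ∀ x, |u x| ≤ M)
    (hb' : ∃ M, ∀ x, |deriv u x| ≤ M) (x : ℝ) :
    HasDerivAt (halfLap u) (halfLap (deriv u) x) x := by
  obtain ⟨M, hM⟩ := hb
  obtain ⟨N, hN⟩ := hb'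
  have hp := Real.pi_pos
  have hu1 : ContDiff ℝ 2 (deriv u) := ContDiff.deriv' hu
  have hu2 : ContDiff ℝ 2 u := hu.of_le (by norm_num)
  have hd1 : ∀ t, HasDerivAt u (deriv u t) t := fun t =>
    ((hu.differentiable (by norm_num)) t).hasDerivAt
  have hd2 : ∀ t, HasDerivAt (deriv u) (deriv (deriv u) t) t := fun t =>
    ((hu1.differentiable (by norm_num)) t).hasDerivAt
  have hm := hu.continuous.measurable
  have hm1 := hu1.continuous.measurable
  have hJ1 : HasDerivAt (J1 1 u) (J1 1 (deriv u) x) x := by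
    obtain ⟨C, hC⟩ := exists_taylor_bound hu1 (x - 2) (x + 2)
    refine (hasDerivAt_integral_of_dominated_loc_of_deriv_le (bound := fun _ => |C| / Real.pi)
      (μ := volume.restrict {z : ℝ | |z| ≤ 1})
      (F := fun y z => (u (y + z) - u y - deriv u y * z) / (Real.pi * z ^ 2))
      (F' := fun y z => (deriv u (y + z) - deriv u y - deriv (deriv u) y * z) / (Real.pi * z ^ 2))
      (ball_mem_nhds x one_pos) (Eventually.of_forall fun y => ?_) (integrableOn_J1 hu2 x)
      ?_ ?_ ?_ ?_).2
    · exact (Measurable.aestronglyMeasurable (by fun_prop))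
    · exact (Measurable.aestronglyMeasurable (by fun_prop))
    · rw [setOf_abs_le_one]
      refine (ae_restrict_iff' measurableSet_Icc).2 (ae_of_all _ fun z hz y hy => ?_)
      rw [mem_ball, Real.dist_eq, abs_lt] at hy
      have h := hC y ⟨by linarith, by linarith⟩ (y + z)
        ⟨by linarith [hz.1], by linarith [hz.2]⟩
      rw [add_sub_cancel_left] at h
      rcases eq_or_ne z 0 with rfl | hz0
      · simp; positivity
      · have hz2 : 0 < z ^ 2 := by positivity
        rw [Real.norm_eq_abs, abs_div, abs_of_pos (by positivity : 0 < Real.pi * z ^ 2),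
          div_le_div_iff₀ (by positivity) hp]
        have : C * z ^ 2 ≤ |C| * z ^ 2 := mul_le_mul_of_nonneg_right (le_abs_self C) hz2.le
        nlinarith
    · rw [setOf_abs_le_one]
      exact integrableOn_const (by simp)
    · refine ae_of_all _ fun z y _ => ?_
      exact ((((hd1 (y + z)).comp_add_const y z).sub (hd1 y)).sub
        ((hd2 y).mul_const z)).div_const _
  have hJ2 : HasDerivAt (J2 1 u) (J2 1 (deriv u) x) x := by
    refine (hasDerivAt_integral_of_dominated_loc_of_deriv_le
      (bound := fun z => 2 * N / (Real.pi * z ^ 2))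
      (μ := volume.restrict {z : ℝ | 1 < |z|})
      (F := fun y z => (u (y + z) - u y) / (Real.pi * z ^ 2))
      (F' := fun y z => (deriv u (y + z) - deriv u y) / (Real.pi * z ^ 2))
      (ball_mem_nhds x one_pos) (Eventually.of_forall fun y => ?_)
      (integrableOn_J2 hu.continuous hM x) ?_ ?_ (integrableOn_tail_bound (2 * N)) ?_).2
    · exact (Measurable.aestronglyMeasurable (by fun_prop))
    · exact (Measurable.aestronglyMeasurable (by fun_prop))
    · refine ae_of_all _ fun z y _ => ?_
      rw [Real.norm_eq_abs, abs_div, abs_of_nonneg (by positivity : 0 ≤ Real.pi * z ^ 2)]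
      refine div_le_div_of_nonneg_right ?_ (by positivity)
      calc |deriv u (y + z) - deriv u y| ≤ |deriv u (y + z)| + |deriv u y| := abs_sub _ _
        _ ≤ 2 * N := by linarith [hN y, hN (y + z)]
    · refine ae_of_all _ fun z y _ => ?_
      exact (((hd1 (y + z)).comp_add_const y z).sub (hd1 y)).div_const _
  exact hJ1.add hJ2

lemma tendsto_log_sub_log {l : Filter ℝ} (hl : Tendsto (fun z : ℝ => z⁻¹) l (𝓝 0))
    (h0 : ∀ᶠ z in l, z ≠ 0) {a : ℝ} (ha : 0 < a) (x : ℝ) :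
    Tendsto (fun z => Real.log (a ^ 2 + (x + z) ^ 2) - 2 * Real.log z) l (𝓝 0) := by
  have h1 : Tendsto (fun z : ℝ => (a ^ 2 + x ^ 2) * (z⁻¹) ^ 2 + 2 * x * z⁻¹ + 1) l (𝓝 1) := by
    simpa using (((hl.pow 2).const_mul (a ^ 2 + x ^ 2)).add (hl.const_mul (2 * x))).add_const 1
  have h2 := h1.log one_ne_zero
  rw [Real.log_one] at h2
  refine h2.congr' ?_
  filter_upwards [h0] with z hz
  have : (a ^ 2 + x ^ 2) * (z⁻¹) ^ 2 + 2 * x * z⁻¹ + 1 = (a ^ 2 + (x + z) ^ 2) / z ^ 2 := by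
    field_simp
    ring
  rw [this, Real.log_div (by positivity) (by positivity), Real.log_pow]
  norm_num

/-- Evaluation of `halfLap` from a logarithm–arctangent primitive with a decaying correction. -/
lemma halfLap_eq_of_arctan_primitive {U S : ℝ → ℝ} (hU : BddC2 U) {x a B : ℝ} (ha : 0 < a)
    (hS : Continuous S) (hSb : Tendsto S atBot (𝓝 0)) (hSt : Tendsto S atTop (𝓝 0))
    (hd : ∀ z ≠ 0, HasDerivAt
      (fun z => S z + (-(deriv U x) / 2 * Real.log (a ^ 2 + (x + z) ^ 2) +
        B * Real.arctan ((x + z) / a)))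
      ((U (x + z) - U x - deriv U x * z) / z ^ 2) z) :
    halfLap U x = B := by
  have hpos : ∀ z : ℝ, a ^ 2 + (x + z) ^ 2 ≠ 0 := fun z => by positivity
  have key : ∀ {l : Filter ℝ} {c : ℝ}, Tendsto (fun z : ℝ => z⁻¹) l (𝓝 0) → (∀ᶠ z in l, z ≠ 0) →
      Tendsto S l (𝓝 0) → Tendsto (fun z => Real.arctan ((x + z) / a)) l (𝓝 c) →
      Tendsto (fun z => S z + (-(deriv U x) / 2 * Real.log (a ^ 2 + (x + z) ^ 2) +
        B * Real.arctan ((x + z) / a)) + deriv U x * Real.log z) l (𝓝 (B * c)) := by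
    intro l c h1 h2 h3 h4
    have := (h3.add ((tendsto_log_sub_log h1 h2 ha x).const_mul (-(deriv U x) / 2))).add
      (h4.const_mul B)
    rw [mul_zero, add_zero, zero_add] at this
    refine this.congr fun z => ?_
    ring
  have h := halfLap_eq_of_primitive hU (x := x) (hS.add ((continuous_const.mul
    (Continuous.log (by fun_prop) hpos)).add
    (continuous_const.mul (Real.continuous_arctan.comp (by fun_prop))))) hd
    (key tendsto_inv_atBot_zero (eventually_ne_atBot 0) hSb
      ((tendsto_nhds_of_tendsto_nhdsWithin Real.tendsto_arctan_atBot).comp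
        ((tendsto_atBot_add_const_left _ x tendsto_id).atBot_div_const ha)))
    (key tendsto_inv_atTop_zero (eventually_ne_atTop 0) hSt
      ((tendsto_nhds_of_tendsto_nhdsWithin Real.tendsto_arctan_atTop).comp
        ((tendsto_atTop_add_const_left _ x tendsto_id).atTop_div_const ha)))
  rw [h]
  field_simp
  ring

lemma hasDerivAt_log_quadratic {a : ℝ} (ha : 0 < a) (x z : ℝ) :
    HasDerivAt (fun z => Real.log (a ^ 2 + (x + z) ^ 2))
      (2 * (x + z) / (a ^ 2 + (x + z) ^ 2)) z := by
  have h : HasDerivAt (fun z => a ^ 2 + (x + z) ^ 2) (2 * (x + z)) z := by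
    simpa using (((hasDerivAt_id' z).const_add x).pow 2).const_add (a ^ 2)
  exact h.log (by positivity)

lemma hasDerivAt_arctan_div {a : ℝ} (ha : 0 < a) (x z : ℝ) :
    HasDerivAt (fun z => Real.arctan ((x + z) / a)) (a / (a ^ 2 + (x + z) ^ 2)) z := by
  have h := (((hasDerivAt_id' z).const_add x).div_const a).arctan
  refine h.congr_deriv ?_
  have : a ^ 2 + (x + z) ^ 2 ≠ 0 := by positivity
  field_simp

/-- The Poisson-type profile `1 / (a² + x²)`, used as a barrier. -/
def barrier (a x : ℝ) : ℝ := 1 / (a ^ 2 + x ^ 2)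

lemma contDiff_barrier {a : ℝ} (ha : 0 < a) {n : WithTop ℕ∞} : ContDiff ℝ n (barrier a) :=
  contDiff_const.div (contDiff_const.add (contDiff_id.pow 2)) fun x => by
    have : 0 < a ^ 2 + x ^ 2 := by positivity
    exact this.ne'

lemma hasDerivAt_barrier {a : ℝ} (ha : 0 < a) (x : ℝ) :
    HasDerivAt (barrier a) (-(2 * x) / (a ^ 2 + x ^ 2) ^ 2) x := by
  have h : HasDerivAt (fun z => a ^ 2 + z ^ 2) (2 * x) x := by
    simpa using ((hasDerivAt_id' x).pow 2).const_add (a ^ 2)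
  have h2 := h.fun_inv (by positivity)
  refine HasDerivAt.congr_of_eventuallyEq (h2.congr_deriv (by ring)) ?_
  exact Eventually.of_forall fun z => by simp [barrier]

lemma bddC2_barrier {a : ℝ} (ha : 0 < a) : BddC2 (barrier a) := by
  refine ⟨contDiff_barrier ha, 1 / a ^ 2, fun x => ?_⟩
  unfold barrier
  rw [abs_of_nonneg (by positivity)]
  exact one_div_le_one_div_of_le (by positivity) (by nlinarith [sq_nonneg x])

lemma halfLap_barrier {a : ℝ} (ha : 0 < a) (x : ℝ) :
    halfLap (barrier a) x = 1 / a * barrier a x * (2 * x ^ 2 * barrier a x - 1) := by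
  refine halfLap_eq_of_arctan_primitive (bddC2_barrier ha) ha (S := fun _ => 0) continuous_const
    tendsto_const_nhds tendsto_const_nhds fun z hz => ?_
  rw [(hasDerivAt_barrier ha x).deriv]
  have h := (((hasDerivAt_log_quadratic ha x z).const_mul (-(-(2 * x) / (a ^ 2 + x ^ 2) ^ 2) / 2)).add
    ((hasDerivAt_arctan_div ha x z).const_mul
      (1 / a * barrier a x * (2 * x ^ 2 * barrier a x - 1)))).const_add 0
  refine h.congr_deriv ?_
  unfold barrier
  have h1 : a ^ 2 + (x + z) ^ 2 ≠ 0 := by positivity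
  have h2 : a ^ 2 + x ^ 2 ≠ 0 := by positivity
  field_simp
  ring

lemma halfLap_barrier_le {a : ℝ} (ha : 0 < a) (x : ℝ) :
    halfLap (barrier a) x ≤ 1 / a * barrier a x := by
  rw [halfLap_barrier ha]
  have h0 : 0 ≤ 1 / a * barrier a x := by unfold barrier; positivity
  have h1 : 2 * x ^ 2 * barrier a x ≤ 2 := by
    unfold barrier
    rw [mul_one_div, div_le_iff₀ (by positivity)]
    nlinarith [sq_nonneg a]
  nlinarith

/-- The conjugate Poisson profile `x / (1 + x²)`. -/
def conjPoisson (x : ℝ) : ℝ := x / (1 + x ^ 2)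

lemma hasDerivAt_conjPoisson (x : ℝ) :
    HasDerivAt conjPoisson ((1 - x ^ 2) / (1 + x ^ 2) ^ 2) x := by
  have h : HasDerivAt (fun z : ℝ => 1 + z ^ 2) (2 * x) x := by
    simpa using ((hasDerivAt_id' x).pow 2).const_add (1:ℝ)
  refine ((hasDerivAt_id' x).fun_div h (by positivity)).congr_deriv ?_
  ring

lemma abs_conjPoisson_le (x : ℝ) : |conjPoisson x| ≤ 1 := by
  unfold conjPoisson
  rw [abs_div, abs_of_pos (by positivity : 0 < 1 + x ^ 2), div_le_one (by positivity), ← sq_abs]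
  nlinarith [sq_nonneg (|x| - 1), abs_nonneg x]

lemma bddC2_conjPoisson : BddC2 conjPoisson :=
  ⟨contDiff_id.div (contDiff_const.add (contDiff_id.pow 2)) fun x => by
    have : 0 < 1 + x ^ 2 := by positivity
    exact this.ne', 1, abs_conjPoisson_le⟩

lemma halfLap_conjPoisson (x : ℝ) :
    halfLap conjPoisson x = -2 * x / (1 + x ^ 2) ^ 2 := by
  refine halfLap_eq_of_arctan_primitive bddC2_conjPoisson one_pos (S := fun _ => 0)
    continuous_const tendsto_const_nhds tendsto_const_nhds fun z hz => ?_
  rw [(hasDerivAt_conjPoisson x).deriv]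
  have h := (((hasDerivAt_log_quadratic one_pos x z).const_mul
    (-((1 - x ^ 2) / (1 + x ^ 2) ^ 2) / 2)).add
    ((hasDerivAt_arctan_div one_pos x z).const_mul (-2 * x / (1 + x ^ 2) ^ 2))).const_add 0
  refine h.congr_deriv ?_
  unfold conjPoisson
  have h1 : 1 + (x + z) ^ 2 ≠ 0 := by positivity
  have h2 : 1 + x ^ 2 ≠ 0 := by positivity
  simp only [one_pow]
  field_simp
  ring

lemma bddC2_arctan : BddC2 Real.arctan :=
  ⟨Real.contDiff_arctan, Real.pi / 2, fun x =>
    abs_le.2 ⟨(Real.neg_pi_div_two_lt_arctan x).le, (Real.arctan_lt_pi_div_two x).le⟩⟩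

lemma halfLap_arctan (x : ℝ) : halfLap Real.arctan x = -conjPoisson x := by
  have hcd : Continuous (dslope Real.arctan x) := by
    rw [← continuousOn_univ, continuousOn_dslope univ_mem]
    exact ⟨Real.continuous_arctan.continuousOn, Real.differentiable_arctan x⟩
  have hds : ∀ z ≠ 0, -dslope Real.arctan x (x + z) =
      -((Real.arctan (x + z) - Real.arctan x) / z) := by
    intro z hz
    rw [dslope_of_ne _ (by simpa using hz), slope_def_field, add_sub_cancel_left]
  have hlim : ∀ {l : Filter ℝ}, Tendsto (fun z : ℝ => z⁻¹) l (𝓝 0) → (∀ᶠ z in l, z ≠ 0) →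
      Tendsto (fun z => -dslope Real.arctan x (x + z)) l (𝓝 0) := by
    intro l h1 h2
    refine squeeze_zero_norm' (a := fun z => Real.pi * |z⁻¹|) ?_ ?_
    · filter_upwards [h2] with z hz
      rw [hds z hz, norm_neg, Real.norm_eq_abs, abs_div, abs_inv, div_eq_mul_inv]
      refine mul_le_mul_of_nonneg_right (abs_le.2 ⟨?_, ?_⟩) (by positivity) <;>
      linarith [Real.neg_pi_div_two_lt_arctan x, Real.arctan_lt_pi_div_two x,
        Real.neg_pi_div_two_lt_arctan (x + z), Real.arctan_lt_pi_div_two (x + z)]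
    · simpa using h1.abs.const_mul Real.pi
  refine halfLap_eq_of_arctan_primitive bddC2_arctan one_pos
    (S := fun z => -dslope Real.arctan x (x + z)) (hcd.comp (by fun_prop)).neg
    (hlim tendsto_inv_atBot_zero (eventually_ne_atBot 0))
    (hlim tendsto_inv_atTop_zero (eventually_ne_atTop 0)) fun z hz => ?_
  rw [(Real.hasDerivAt_arctan x).deriv]
  have h1 : 1 + (x + z) ^ 2 ≠ 0 := by positivity
  have h2 : 1 + x ^ 2 ≠ 0 := by positivity
  have h3 : HasDerivAt (fun z => -dslope Real.arctan x (x + z))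
      (-((1 / (1 + (x + z) ^ 2) * z - (Real.arctan (x + z) - Real.arctan x) * 1) / z ^ 2)) z := by
    have := (((Real.hasDerivAt_arctan (x + z)).comp_const_add x z).sub_const
      (Real.arctan x)).fun_div (hasDerivAt_id' z) hz
    refine this.fun_neg.congr_of_eventuallyEq ?_
    filter_upwards [isOpen_ne.mem_nhds hz] with y hy
    exact hds y hy
  have h := h3.add (((hasDerivAt_log_quadratic one_pos x z).const_mul
    (-(1 / (1 + x ^ 2)) / 2)).add
    ((hasDerivAt_arctan_div one_pos x z).const_mul (-conjPoisson x)))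
  refine h.congr_deriv ?_
  unfold conjPoisson
  simp only [one_pow]
  field_simp
  ring

/-- One-sided comparison with the barrier, with a constant independent of the function. -/
lemma exists_upper_bound_of_coercive {m : ℝ} (hm : 0 < m) (R C M : ℝ) :
    ∃ K, 0 < K ∧ ∀ u : ℝ → ℝ, BddC2 u → Tendsto u (cocompact ℝ) (𝓝 0) →
      (∀ x, |x| ≤ R → u x ≤ M) →
      (∀ x, R < |x| → ∃ v ≥ m, v * u x - C / (1 + x ^ 2) ≤ halfLap u x) →
      ∀ x, u x ≤ K / (1 + x ^ 2) := by
  set a : ℝ := max 1 (2 / m) with ha_def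
  have ha1 : 1 ≤ a := le_max_left _ _
  have ha0 : 0 < a := by linarith
  have ham : 1 / a ≤ m / 2 := by
    rw [div_le_div_iff₀ ha0 two_pos]
    have : 2 / m ≤ a := le_max_right _ _
    rw [div_le_iff₀ hm] at this
    linarith
  set K := (|M| + 1) * (a ^ 2 + R ^ 2) + (|C| + 1) * (2 * a ^ 2 / m) with hK
  have hK1 : 0 ≤ (|M| + 1) * (a ^ 2 + R ^ 2) := by positivity
  have hK2 : 0 < (|C| + 1) * (2 * a ^ 2 / m) := by positivity
  have hK0 : 0 < K := by linarith
  have hbar : ∀ x, barrier a x ≤ 1 / (1 + x ^ 2) := fun x =>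
    one_div_le_one_div_of_le (by positivity) (by nlinarith)
  have hbar' : ∀ x, 1 / (1 + x ^ 2) ≤ a ^ 2 * barrier a x := fun x => by
    unfold barrier
    rw [mul_one_div, div_le_div_iff₀ (by positivity) (by positivity)]
    nlinarith [mul_nonneg (sq_nonneg x) (by nlinarith : 0 ≤ a ^ 2 - 1)]
  refine ⟨K, hK0, fun u hu hlim hin hout => ?_⟩
  suffices h : ∀ x, u x ≤ K * barrier a x by
    intro x
    refine (h x).trans ?_
    rw [div_eq_mul_one_div]
    exact mul_le_mul_of_nonneg_left (hbar x) hK0.le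
  by_contra! hcon
  obtain ⟨x₁, hx₁⟩ := hcon
  have hB := (bddC2_barrier ha0).const_mul K
  have hbpos : ∀ x, 0 < barrier a x := fun x => by unfold barrier; positivity
  have hev : ∀ᶠ x in cocompact ℝ, u x - K * barrier a x ≤ u x₁ - K * barrier a x₁ := by
    filter_upwards [hlim.eventually_lt_const (sub_pos.2 hx₁)] with x hx
    have := mul_pos hK0 (hbpos x)
    linarith
  obtain ⟨x₀, hx₀⟩ := (hu.1.continuous.sub hB.1.continuous).exists_forall_ge' x₁ hev
  have hpos : 0 < u x₀ - K * barrier a x₀ := (sub_pos.2 hx₁).trans_le (hx₀ x₁)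
  have hR : R < |x₀| := by
    by_contra! hle
    have h1 := hin x₀ hle
    have h2 : |M| + 1 ≤ K * barrier a x₀ := by
      unfold barrier
      rw [mul_one_div, le_div_iff₀ (by positivity)]
      have : x₀ ^ 2 ≤ R ^ 2 := by
        rw [← sq_abs]; exact pow_le_pow_left₀ (abs_nonneg _) hle 2
      nlinarith [abs_nonneg M]
    linarith [le_abs_self M]
  obtain ⟨v, hv, hle⟩ := hout x₀ hR
  have hmax := halfLap_nonpos_of_max (u := fun x => u x - K * barrier a x) hx₀
  rw [halfLap_sub hu hB, halfLap_const_mul (bddC2_barrier ha0)] at hmax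
  have h3 : K * halfLap (barrier a) x₀ ≤ K * (m / 2 * barrier a x₀) :=
    mul_le_mul_of_nonneg_left ((halfLap_barrier_le ha0 x₀).trans
      (mul_le_mul_of_nonneg_right ham (hbpos x₀).le)) hK0.le
  have hKb := mul_pos hK0 (hbpos x₀)
  have h4 : m * (K * barrier a x₀) ≤ v * u x₀ := by nlinarith
  have h5 : C / (1 + x₀ ^ 2) ≤ |C| * (a ^ 2 * barrier a x₀) := by
    rw [div_eq_mul_one_div]
    exact (mul_le_mul_of_nonneg_right (le_abs_self C) (by positivity)).trans
      (mul_le_mul_of_nonneg_left (hbar' x₀) (abs_nonneg C))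
  have h6 : (|C| + 1) * (a ^ 2 * barrier a x₀) ≤ m / 2 * (K * barrier a x₀) := by
    have : (|C| + 1) * (2 * a ^ 2 / m) ≤ K := by linarith
    have h7 := mul_le_mul_of_nonneg_left this (by positivity : 0 ≤ m / 2)
    have h8 : m / 2 * ((|C| + 1) * (2 * a ^ 2 / m)) = (|C| + 1) * a ^ 2 := by field_simp
    rw [h8] at h7
    nlinarith [hbpos x₀]
  have h9 : 0 < a ^ 2 * barrier a x₀ := mul_pos (by positivity) (hbpos x₀)
  nlinarith

/-- Quadratic decay for solutions of a linear equation that is coercive near infinity, with a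
constant independent of the solution. -/
lemma exists_bound_of_coercive {m : ℝ} (hm : 0 < m) (R C M : ℝ) :
    ∃ K, 0 < K ∧ ∀ u : ℝ → ℝ, BddC2 u → Tendsto u (cocompact ℝ) (𝓝 0) →
      (∀ x, |x| ≤ R → |u x| ≤ M) →
      (∀ x, R < |x| → ∃ v ≥ m, |halfLap u x - v * u x| ≤ C / (1 + x ^ 2)) →
      ∀ x, |u x| ≤ K / (1 + x ^ 2) := by
  obtain ⟨K, hK, h⟩ := exists_upper_bound_of_coercive hm R C M
  refine ⟨K, hK, fun u hu hlim hin hout x => abs_le.2 ⟨?_, ?_⟩⟩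
  · have := h (fun x => -1 * u x) (hu.const_mul (-1)) (by simpa using hlim.neg)
      (fun x hx => by linarith [(abs_le.1 (hin x hx)).1]) (fun x hx => by
        obtain ⟨v, hv, hvx⟩ := hout x hx
        refine ⟨v, hv, ?_⟩
        rw [halfLap_const_mul hu]
        linarith [(abs_le.1 hvx).2]) x
    linarith
  · exact h u hu hlim (fun x hx => (abs_le.1 (hin x hx)).2) (fun x hx => by
      obtain ⟨v, hv, hvx⟩ := hout x hx
      exact ⟨v, hv, by linarith [(abs_le.1 hvx).1]⟩) x

/-- `f = O(1 / (1 + x²))` on the whole line. -/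
def QuadDecay (f : ℝ → ℝ) : Prop := ∃ K, ∀ x, |f x| ≤ K / (1 + x ^ 2)

lemma QuadDecay.exists_pos {f : ℝ → ℝ} (hf : QuadDecay f) :
    ∃ K, 0 < K ∧ ∀ x, |f x| ≤ K / (1 + x ^ 2) := by
  obtain ⟨K, hK⟩ := hf
  refine ⟨|K| + 1, by positivity, fun x => (hK x).trans ?_⟩
  exact div_le_div_of_nonneg_right (by linarith [le_abs_self K]) (by positivity)

lemma QuadDecay.mono {f g : ℝ → ℝ} (hf : QuadDecay f) (h : ∀ x, |g x| ≤ |f x|) : QuadDecay g := by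
  obtain ⟨K, hK⟩ := hf
  exact ⟨K, fun x => (h x).trans (hK x)⟩

lemma QuadDecay.add {f g : ℝ → ℝ} (hf : QuadDecay f) (hg : QuadDecay g) :
    QuadDecay (fun x => f x + g x) := by
  obtain ⟨K, hK⟩ := hf
  obtain ⟨N, hN⟩ := hg
  exact ⟨K + N, fun x => (abs_add_le _ _).trans (by rw [add_div]; exact add_le_add (hK x) (hN x))⟩

lemma QuadDecay.bdd_mul {f g : ℝ → ℝ} (hf : QuadDecay f) (hg : ∃ M, ∀ x, |g x| ≤ M) :
    QuadDecay (fun x => g x * f x) := by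
  obtain ⟨K, hK⟩ := hf
  obtain ⟨M, hM⟩ := hg
  refine ⟨M * K, fun x => ?_⟩
  rw [abs_mul, mul_div_assoc]
  exact mul_le_mul (hM x) (hK x) (abs_nonneg _) ((abs_nonneg _).trans (hM x))

lemma QuadDecay.const_mul {f : ℝ → ℝ} (hf : QuadDecay f) (c : ℝ) :
    QuadDecay (fun x => c * f x) :=
  hf.bdd_mul ⟨|c|, fun _ => le_rfl⟩

lemma QuadDecay.bdd {f : ℝ → ℝ} (hf : QuadDecay f) : ∃ M, ∀ x, |f x| ≤ M := by
  obtain ⟨K, hK, h⟩ := hf.exists_pos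
  refine ⟨K, fun x => (h x).trans (div_le_self hK.le ?_)⟩
  nlinarith [sq_nonneg x]

lemma quadDecay_of_abs_le {f : ℝ → ℝ} {M C : ℝ} (hM : ∀ x, |x| < 1 → |f x| ≤ M)
    (hC : ∀ x, 1 ≤ |x| → |f x| ≤ C / x ^ 2) : QuadDecay f := by
  refine ⟨2 * |M| + 2 * |C|, fun x => ?_⟩
  have h0 := abs_nonneg M
  have h0' := abs_nonneg C
  rw [le_div_iff₀ (by positivity)]
  rcases lt_or_ge |x| 1 with hx | hx
  · have h1 := (hM x hx).trans (le_abs_self M)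
    have h2 : x ^ 2 ≤ 1 := by rw [← sq_abs]; nlinarith [abs_nonneg x]
    nlinarith [abs_nonneg (f x), sq_nonneg x]
  · have h2 : 1 ≤ x ^ 2 := by rw [← sq_abs]; nlinarith
    have h1 := hC x hx
    rw [le_div_iff₀ (by linarith)] at h1
    nlinarith [abs_nonneg (f x), le_abs_self C]

lemma tendsto_one_add_sq_cocompact : Tendsto (fun x : ℝ => 1 + x ^ 2) (cocompact ℝ) atTop := by
  have h := (tendsto_pow_atTop (α := ℝ) two_ne_zero).comp (tendsto_norm_cocompact_atTop (E := ℝ))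
  refine tendsto_atTop_add_const_left _ _ (h.congr fun x => ?_)
  simp

lemma QuadDecay.tendsto_zero {f : ℝ → ℝ} (hf : QuadDecay f) :
    Tendsto f (cocompact ℝ) (𝓝 0) := by
  obtain ⟨K, hK⟩ := hf
  exact squeeze_zero_norm hK (tendsto_one_add_sq_cocompact.const_div_atTop K)

lemma exists_forall_abs_lt {p : ℝ → Prop} (h : ∀ᶠ x in cocompact ℝ, p x) :
    ∃ R : ℝ, ∀ x, R < |x| → p x := by
  rw [cocompact_eq_atBot_atTop, eventually_sup, eventually_atBot, eventually_atTop] at h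
  obtain ⟨⟨A, hA⟩, B, hB⟩ := h
  refine ⟨max |A| |B|, fun x hx => ?_⟩
  obtain ⟨h1, h2⟩ := max_lt_iff.1 hx
  rcases lt_abs.1 h1 with h | h
  · rcases le_total 0 x with h0 | h0
    · exact hB x (by rw [abs_of_nonneg h0] at h2; linarith [le_abs_self B])
    · linarith [abs_nonneg A]
  · exact hA x (by linarith [neg_abs_le A])

lemma div_one_add_sq_le {K x y : ℝ} (hK : 0 ≤ K) (h : |y - x| ≤ 1) :
    K / (1 + y ^ 2) ≤ 3 * K / (1 + x ^ 2) := by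
  rw [div_le_div_iff₀ (by positivity) (by positivity)]
  have h1 : (y - x) ^ 2 ≤ 1 := by rw [← sq_abs]; nlinarith [abs_nonneg (y - x)]
  nlinarith [sq_nonneg (2 * y - x), sq_nonneg (x - 2 * y), sq_nonneg y]

/-- Decay of increments of a function with quadratically decaying derivative. -/
lemma abs_sub_le_of_quadDecay {G : ℝ → ℝ} (hG : Differentiable ℝ G) {K : ℝ} (hK0 : 0 ≤ K)
    (hK : ∀ x, |deriv G x| ≤ K / (1 + x ^ 2)) {h : ℝ} (h0 : 0 < h) (h1 : h ≤ 1) (x : ℝ) :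
    |G (x + h) - G x| ≤ 3 * K / (1 + x ^ 2) * h := by
  obtain ⟨y, hy, hyx⟩ := exists_deriv_eq_slope G (by linarith : x < x + h)
    hG.continuous.continuousOn hG.differentiableOn
  rw [add_sub_cancel_left] at hyx
  have h2 := (hK y).trans (div_one_add_sq_le hK0
    (abs_le.2 ⟨by linarith [hy.1], by linarith [hy.2]⟩ : |y - x| ≤ 1))
  rwa [hyx, abs_div, abs_of_pos h0, div_le_iff₀ h0] at h2

/-- Quadratic decay of the derivative, by comparison for difference quotients. -/
lemma quadDecay_deriv {u F : ℝ → ℝ} (hu : BddC2 u) (hF : ∀ x, halfLap u x = F x)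
    (hlim : ∀ h, Tendsto (fun x => u (x + h) - u x) (cocompact ℝ) (𝓝 0))
    {m R C : ℝ} (hm : 0 < m)
    (hv : ∀ h, 0 < h → h ≤ 1 → ∀ x, R < |x| → ∃ v ≥ m,
      |F (x + h) - F x - v * (u (x + h) - u x)| ≤ C / (1 + x ^ 2) * h) :
    QuadDecay (deriv u) := by
  have hdc : Continuous (deriv u) := hu.1.continuous_deriv (by norm_num)
  obtain ⟨M, hM⟩ := isCompact_Icc.exists_bound_of_continuousOn (s := Icc (-R) (R + 1))
    hdc.continuousOn
  obtain ⟨K, -, hK⟩ := exists_bound_of_coercive hm R C M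
  have key : ∀ h, 0 < h → h ≤ 1 → ∀ x, |h⁻¹ * (u (x + h) - u x)| ≤ K / (1 + x ^ 2) := by
    intro h h0 h1
    have hD := ((hu.comp_add_const h).sub hu)
    refine hK (fun x => h⁻¹ * (u (x + h) - u x)) (hD.const_mul h⁻¹) ?_ ?_ ?_
    · simpa using (hlim h).const_mul h⁻¹
    · intro x hx
      obtain ⟨y, hy, hyx⟩ := exists_deriv_eq_slope u (by linarith : x < x + h)
        hu.1.continuous.continuousOn hu.differentiable.differentiableOn
      rw [add_sub_cancel_left] at hyx
      rw [← div_eq_inv_mul, ← hyx]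
      obtain ⟨hx1, hx2⟩ := abs_le.1 hx
      exact hM y ⟨by linarith [hy.1], by linarith [hy.2]⟩
    · intro x hx
      obtain ⟨v, hvm, hvx⟩ := hv h h0 h1 x hx
      refine ⟨v, hvm, ?_⟩
      rw [halfLap_const_mul hD, halfLap_sub (hu.comp_add_const h) hu, halfLap_comp_add_const,
        hF, hF]
      have : h⁻¹ * (F (x + h) - F x) - v * (h⁻¹ * (u (x + h) - u x)) =
          (F (x + h) - F x - v * (u (x + h) - u x)) / h := by
        field_simp
      rw [this, abs_div, abs_of_pos h0, div_le_iff₀ h0]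
      exact hvx
  refine ⟨K, fun x => ?_⟩
  have ht : Tendsto (fun h => |h⁻¹ * (u (x + h) - u x)|) (𝓝[>] 0) (𝓝 |deriv u x|) :=
    ((hu.differentiable x).hasDerivAt.tendsto_slope_zero_right).abs
  refine le_of_tendsto ht ?_
  filter_upwards [Ioc_mem_nhdsGT one_pos] with h hh
  exact key h hh.1 hh.2 x

lemma tendsto_comp_add_const_cocompact (h : ℝ) :
    Tendsto (fun x : ℝ => x + h) (cocompact ℝ) (cocompact ℝ) :=
  (Homeomorph.addRight h).isClosedEmbedding.tendsto_cocompact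

/-- Quadratic decay of the derivative of a solution of a linear equation whose coefficients have
quadratically decaying derivatives. -/
lemma quadDecay_deriv_of_linear {u V G : ℝ → ℝ} (hu : BddC2 u) (hlim : Tendsto u (cocompact ℝ) (𝓝 0))
    (hV : Differentiable ℝ V) (hG : Differentiable ℝ G)
    (hF : ∀ x, halfLap u x = V x * u x + G x) {α : ℝ} (hα : 0 < α)
    (hVα : Tendsto V (cocompact ℝ) (𝓝 α)) (hV' : QuadDecay (deriv V))
    (hG' : QuadDecay (deriv G)) : QuadDecay (deriv u) := by
  obtain ⟨K, hK0, hK⟩ := hV'.exists_pos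
  obtain ⟨N, hN0, hN⟩ := hG'.exists_pos
  obtain ⟨M, hM⟩ := hu.2
  obtain ⟨R, hR⟩ := exists_forall_abs_lt (hVα.eventually_const_lt (half_lt_self hα))
  refine quadDecay_deriv hu hF (R := R + 1) (C := 3 * K * M + 3 * N) (fun h => ?_) (half_pos hα) ?_
  · simpa using (hlim.comp (tendsto_comp_add_const_cocompact h)).sub hlim
  · intro h h0 h1 x hx
    refine ⟨V (x + h), (hR _ ?_).le, ?_⟩
    · have h2 := abs_sub_abs_le_abs_sub x (x + h)
      rw [sub_add_cancel_left, abs_neg, abs_of_pos h0] at h2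
      linarith
    · have e1 := abs_sub_le_of_quadDecay hV hK0.le hK h0 h1 x
      have e2 := abs_sub_le_of_quadDecay hG hN0.le hN h0 h1 x
      have e3 : V (x + h) * u (x + h) + G (x + h) - (V x * u x + G x) -
          V (x + h) * (u (x + h) - u x) = (V (x + h) - V x) * u x + (G (x + h) - G x) := by ring
      rw [e3]
      calc _ ≤ |V (x + h) - V x| * |u x| + |G (x + h) - G x| := by
            rw [← abs_mul]; exact abs_add_le _ _
        _ ≤ (3 * K / (1 + x ^ 2) * h) * M + 3 * N / (1 + x ^ 2) * h :=
            add_le_add (mul_le_mul e1 (hM x) (abs_nonneg _) (by positivity)) e2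
        _ = _ := by ring

/-- The equation satisfied by the derivative. -/
lemma halfLap_deriv {u V G : ℝ → ℝ} (hu : ContDiff ℝ 3 u) (hb : ∃ M, ∀ x, |u x| ≤ M)
    (hb' : ∃ M, ∀ x, |deriv u x| ≤ M) (hV : Differentiable ℝ V) (hG : Differentiable ℝ G)
    (hF : ∀ x, halfLap u x = V x * u x + G x) (x : ℝ) :
    halfLap (deriv u) x = V x * deriv u x + (deriv V x * u x + deriv G x) := by
  have h1 := hasDerivAt_halfLap hu hb hb' x
  have h2 := ((hV x).hasDerivAt.fun_mul
    ((hu.differentiable (by norm_num)) x).hasDerivAt).fun_add (hG x).hasDerivAt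
  rw [funext hF] at h1
  rw [h1.unique h2]
  ring

lemma quadDecay_of_coercive {u V : ℝ → ℝ} (hu : BddC2 u) (hlim : Tendsto u (cocompact ℝ) (𝓝 0))
    {α : ℝ} (hα : 0 < α) (hV : Tendsto V (cocompact ℝ) (𝓝 α))
    (h : QuadDecay (fun x => halfLap u x - V x * u x)) : QuadDecay u := by
  obtain ⟨C, hC⟩ := h
  obtain ⟨M, hM⟩ := hu.2
  obtain ⟨R, hR⟩ := exists_forall_abs_lt (hV.eventually_const_lt (half_lt_self hα))
  obtain ⟨K, -, hK⟩ := exists_bound_of_coercive (half_pos hα) R C M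
  exact ⟨K, hK u hu hlim (fun x _ => hM x) fun x hx => ⟨V x, (hR x hx).le, hC x⟩⟩

lemma arctan_bounds {y : ℝ} (hy : 0 < y) :
    y / (1 + y ^ 2) ≤ Real.arctan y ∧ Real.arctan y ≤ y := by
  obtain ⟨t, ht, hty⟩ := exists_deriv_eq_slope Real.arctan hy
    Real.continuous_arctan.continuousOn Real.differentiable_arctan.differentiableOn
  rw [Real.deriv_arctan, Real.arctan_zero, sub_zero, sub_zero, eq_div_iff hy.ne'] at hty
  rw [← hty, one_div_mul_eq_div]
  have h1 : t ^ 2 ≤ y ^ 2 := pow_le_pow_left₀ ht.1.le ht.2.le 2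
  exact ⟨div_le_div_of_nonneg_left hy.le (by positivity) (by linarith),
    div_le_self hy.le (by nlinarith [sq_nonneg t])⟩

lemma abs_arctan_sub_le {y : ℝ} (hy : 0 < y) (hy1 : y ≤ 1) :
    |Real.arctan y - y / (1 + y ^ 2)| ≤ y ^ 2 := by
  obtain ⟨h1, h2⟩ := arctan_bounds hy
  rw [abs_of_nonneg (by linarith)]
  have : y - y / (1 + y ^ 2) ≤ y ^ 2 := by
    rw [sub_le_iff_le_add, ← sub_le_iff_le_add', le_div_iff₀ (by positivity)]
    nlinarith [mul_nonneg hy.le (sub_nonneg.2 hy1), pow_pos hy 3, pow_pos hy 2,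
      mul_nonneg (sq_nonneg y) (sub_nonneg.2 hy1)]
  linarith

lemma conjPoisson_inv {x : ℝ} (hx : x ≠ 0) : conjPoisson x = x⁻¹ / (1 + x⁻¹ ^ 2) := by
  unfold conjPoisson
  field_simp
  ring

lemma conjPoisson_neg (x : ℝ) : conjPoisson (-x) = -conjPoisson x := by
  unfold conjPoisson
  rw [neg_sq, neg_div]

/-- The Heaviside step, equal to `1` exactly on `(0, ∞)`. -/
def step (x : ℝ) : ℝ := if 0 < x then 1 else 0

lemma step_of_pos {x : ℝ} (hx : 0 < x) : step x = 1 := if_pos hx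

lemma step_of_neg {x : ℝ} (hx : x < 0) : step x = 0 := if_neg hx.le.not_gt

lemma step_eq (x : ℝ) : step x = 0 ∨ step x = 1 := by
  unfold step
  split_ifs <;> simp

lemma step_mem (x : ℝ) : step x ∈ Icc (0:ℝ) 1 := by
  rcases step_eq x with h | h <;> simp [h]

/-- The layer `1/2 + arctan x / π`. -/
def arctanLayer (x : ℝ) : ℝ := 1 / 2 + 1 / Real.pi * Real.arctan x

lemma bddC2_const (c : ℝ) : BddC2 (fun _ => c) := ⟨contDiff_const, |c|, fun _ => le_rfl⟩

lemma bddC2_arctanLayer : BddC2 arctanLayer :=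
  (bddC2_const (1 / 2)).add (bddC2_arctan.const_mul _)

lemma halfLap_const (c x : ℝ) : halfLap (fun _ => c) x = 0 := by
  simp [halfLap, J1, J2]

lemma halfLap_arctanLayer (x : ℝ) : halfLap arctanLayer x = -(conjPoisson x / Real.pi) := by
  have h := halfLap_add (bddC2_const (1 / 2)) (bddC2_arctan.const_mul (1 / Real.pi)) x
  rw [halfLap_const, halfLap_const_mul bddC2_arctan, halfLap_arctan] at h
  refine h.trans ?_
  ring

lemma one_le_abs_cases {x : ℝ} (hx : 1 ≤ |x|) : 1 ≤ x ∨ ∃ y, 1 ≤ y ∧ x = -y := by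
  rcases le_abs.1 hx with h | h
  · exact Or.inl h
  · exact Or.inr ⟨-x, h, by ring⟩

lemma quadDecay_arctanLayer :
    QuadDecay (fun x => arctanLayer x - step x + conjPoisson x / Real.pi) := by
  have hp := Real.pi_pos
  have hp1 : 1 ≤ Real.pi := by linarith [Real.pi_gt_three]
  have hmain : ∀ x, 1 ≤ x → |(Real.arctan x⁻¹ - conjPoisson x) / Real.pi| ≤ 1 / x ^ 2 := by
    intro x hx
    have hx0 : 0 < x := by linarith
    have h := abs_arctan_sub_le (inv_pos.2 hx0) (inv_le_one_of_one_le₀ hx)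
    rw [← conjPoisson_inv hx0.ne', inv_pow, ← one_div (x ^ 2)] at h
    rw [abs_div, abs_of_pos hp]
    exact (div_le_self (abs_nonneg _) hp1).trans h
  refine quadDecay_of_abs_le (M := 1 / 2 + 1 / Real.pi * (Real.pi / 2) + 1 + 1) (C := 1)
    (fun x _ => ?_) fun x hx => ?_
  · have h1 : |arctanLayer x| ≤ 1 / 2 + 1 / Real.pi * (Real.pi / 2) := by
      unfold arctanLayer
      refine (abs_add_le _ _).trans (add_le_add (by norm_num) ?_)
      rw [abs_mul, abs_of_pos (by positivity : 0 < 1 / Real.pi)]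
      exact mul_le_mul_of_nonneg_left (abs_le.2 ⟨(Real.neg_pi_div_two_lt_arctan x).le,
        (Real.arctan_lt_pi_div_two x).le⟩) (by positivity)
    have h2 : |step x| ≤ 1 := abs_le.2 ⟨by linarith [(step_mem x).1], (step_mem x).2⟩
    have h3 : |conjPoisson x / Real.pi| ≤ 1 := by
      rw [abs_div, abs_of_pos hp]
      exact (div_le_self (abs_nonneg _) hp1).trans (abs_conjPoisson_le x)
    exact (abs_add_le _ _).trans (add_le_add ((abs_sub _ _).trans (add_le_add h1 h2)) h3)
  · rcases one_le_abs_cases hx with h | ⟨y, hy, rfl⟩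
    · refine (le_of_eq ?_).trans (hmain x h)
      rw [step_of_pos (by linarith), Real.arctan_inv_of_pos (by linarith), ← abs_neg]
      congr 1
      unfold arctanLayer
      field_simp
      ring
    · rw [neg_sq]
      refine (le_of_eq ?_).trans (hmain y hy)
      rw [step_of_neg (by linarith), Real.arctan_inv_of_pos (by linarith), conjPoisson_neg]
      congr 1
      unfold arctanLayer
      rw [Real.arctan_neg]
      field_simp
      ring

lemma quadDecay_conjPoisson_sq : QuadDecay (fun x => conjPoisson x ^ 2) := by
  refine ⟨1, fun x => ?_⟩
  unfold conjPoisson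
  rw [abs_of_nonneg (by positivity)]
  beta_reduce
  rw [div_pow, div_le_div_iff₀ (by positivity) (by positivity)]
  nlinarith [sq_nonneg x]

lemma quadDecay_halfLap_conjPoisson : QuadDecay (halfLap conjPoisson) := by
  refine ⟨2, fun x => ?_⟩
  have h : halfLap conjPoisson x = -2 / (1 + x ^ 2) * conjPoisson x := by
    rw [halfLap_conjPoisson]
    unfold conjPoisson
    field_simp
  rw [h, abs_mul, abs_div, abs_of_pos (by positivity : 0 < 1 + x ^ 2)]
  norm_num
  exact mul_le_of_le_one_right (by positivity) (abs_conjPoisson_le x)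

lemma tendsto_conjPoisson : Tendsto conjPoisson (cocompact ℝ) (𝓝 0) := by
  have h : Tendsto (fun x : ℝ => x⁻¹) (cocompact ℝ) (𝓝 0) := by
    rw [cocompact_eq_atBot_atTop]
    exact tendsto_inv_atBot_zero.sup tendsto_inv_atTop_zero
  refine squeeze_zero_norm (a := fun x => |x⁻¹|) (fun x => ?_) (by simpa using h.abs)
  rcases eq_or_ne x 0 with rfl | hx
  · simp [conjPoisson]
  · rw [conjPoisson_inv hx, Real.norm_eq_abs, abs_div,
      abs_of_pos (by positivity : 0 < 1 + x⁻¹ ^ 2)]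
    exact div_le_self (abs_nonneg _) (by nlinarith [sq_nonneg x⁻¹])

lemma conjPoisson_sub_inv_le {x : ℝ} (hx : 1 ≤ |x|) : |conjPoisson x - 1 / x| ≤ 1 / x ^ 2 := by
  have hx0 : x ≠ 0 := by rintro rfl; norm_num at hx
  have h1 : 1 + x ^ 2 ≠ 0 := by positivity
  have h : conjPoisson x - 1 / x = -(1 / (x * (1 + x ^ 2))) := by
    unfold conjPoisson
    field_simp
    ring
  rw [h, abs_neg, abs_div, abs_one, abs_mul, abs_of_pos (by positivity : 0 < 1 + x ^ 2)]
  exact one_div_le_one_div_of_le (by positivity) (by nlinarith [sq_nonneg x])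

lemma QuadDecay.mul_of_sq {f g : ℝ → ℝ} (hf : QuadDecay (fun x => f x ^ 2))
    (hg : QuadDecay (fun x => g x ^ 2)) : QuadDecay (fun x => f x * g x) := by
  refine (hf.add hg).mono fun x => ?_
  rw [abs_of_nonneg (by positivity : 0 ≤ f x ^ 2 + g x ^ 2), abs_mul, ← sq_abs (f x),
    ← sq_abs (g x)]
  nlinarith [sq_nonneg (|f x| - |g x|), sq_nonneg (|f x|), sq_nonneg (|g x|)]

lemma deriv_periodic {f : ℝ → ℝ} (h : ∀ v, f (v + 1) = f v) (v : ℝ) :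
    deriv f (v + 1) = deriv f v := by
  rw [← deriv_comp_add_const, funext h]

section Potential

variable {W : ℝ → ℝ}

lemma AssumptionW.contDiff (hW : AssumptionW W) : ContDiff ℝ 4 W := by
  obtain ⟨⟨_, _, h, _⟩, _⟩ := hW
  exact h

lemma AssumptionW.contDiff_deriv (hW : AssumptionW W) : ContDiff ℝ 3 (deriv W) :=
  ContDiff.deriv' hW.contDiff

lemma AssumptionW.contDiff_deriv_two (hW : AssumptionW W) : ContDiff ℝ 2 (deriv (deriv W)) :=
  ContDiff.deriv' hW.contDiff_deriv

lemma AssumptionW.pos (hW : AssumptionW W) : 0 < deriv (deriv W) 0 := hW.2.2.2.2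

lemma AssumptionW.deriv_zero (hW : AssumptionW W) : deriv W 0 = 0 := by
  obtain ⟨_, _, h0, hpos, _⟩ := hW
  refine IsLocalMin.deriv_eq_zero (Eventually.of_forall fun v => ?_)
  have h00 : W 0 = 0 := by simpa using h0 0
  rw [h00]
  by_cases hv : ∀ k : ℤ, v ≠ k
  · exact (hpos v hv).le
  · push Not at hv
    obtain ⟨k, rfl⟩ := hv
    exact (h0 k).ge

lemma AssumptionW.deriv_step (hW : AssumptionW W) (x : ℝ) : deriv W (step x) = 0 := by
  have h1 := deriv_periodic hW.2.1 0
  rw [zero_add] at h1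
  rcases step_eq x with h | h <;> simp [h, h1, hW.deriv_zero]

lemma AssumptionW.deriv_two_one (hW : AssumptionW W) :
    deriv (deriv W) 1 = deriv (deriv W) 0 := by
  simpa using deriv_periodic (deriv_periodic hW.2.1) 0

lemma AssumptionW.deriv_two_step (hW : AssumptionW W) (x : ℝ) :
    deriv (deriv W) (step x) = deriv (deriv W) 0 := by
  rcases step_eq x with h | h <;> simp [h, hW.deriv_two_one]

lemma AssumptionW.deriv_three_step (hW : AssumptionW W) (x : ℝ) :
    deriv (deriv (deriv W)) (step x) = deriv (deriv (deriv W)) 0 := by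
  have h1 := deriv_periodic (deriv_periodic (deriv_periodic hW.2.1)) 0
  rw [zero_add] at h1
  rcases step_eq x with h | h <;> simp [h, h1]

end Potential

section Layer

variable {W φ : ℝ → ℝ}

lemma IsPhi.mem_Icc (hφ : IsPhi W φ) (x : ℝ) : φ x ∈ Icc (0:ℝ) 1 := by
  obtain ⟨_, _, hb, ht, _, hpos⟩ := hφ
  have hm := (strictMono_of_deriv_pos hpos).monotone
  exact ⟨hm.le_of_tendsto hb x, hm.ge_of_tendsto ht x⟩

lemma IsPhi.differentiable (hφ : IsPhi W φ) : Differentiable ℝ φ :=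
  hφ.1.differentiable (by norm_num)

lemma IsPhi.bdd_comp (hφ : IsPhi W φ) {f : ℝ → ℝ} (hf : Continuous f) :
    ∃ M, ∀ x, |f (φ x)| ≤ M := by
  obtain ⟨M, hM⟩ := isCompact_Icc.exists_bound_of_continuousOn (s := Icc (0:ℝ) 1) hf.continuousOn
  exact ⟨M, fun x => hM _ (hφ.mem_Icc x)⟩

lemma IsPhi.bddC2 (hφ : IsPhi W φ) : BddC2 φ :=
  ⟨hφ.1.of_le (by norm_num), hφ.bdd_comp continuous_id⟩

lemma IsPhi.tendsto_deriv_two_comp (hW : AssumptionW W) (hφ : IsPhi W φ) :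
    Tendsto (fun x => deriv (deriv W) (φ x)) (cocompact ℝ) (𝓝 (deriv (deriv W) 0)) := by
  have hc := hW.contDiff_deriv_two.continuous
  rw [cocompact_eq_atBot_atTop]
  refine Tendsto.sup ((hc.tendsto 0).comp hφ.2.2.1) ?_
  rw [← hW.deriv_two_one]
  exact (hc.tendsto 1).comp hφ.2.2.2.1

lemma IsPhi.quadDecay_deriv (hW : AssumptionW W) (hφ : IsPhi W φ) : QuadDecay (deriv φ) := by
  obtain ⟨R, hR⟩ := exists_forall_abs_lt
    ((hφ.tendsto_deriv_two_comp hW).eventually_const_lt (half_lt_self hW.pos))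
  have hd := hφ.differentiable
  have hdW : Differentiable ℝ (deriv W) := hW.contDiff_deriv.differentiable (by norm_num)
  refine _root_.quadDecay_deriv hφ.bddC2 (F := fun x => deriv W (φ x)) hφ.2.1 (R := R + 1) (C := 0)
    (fun h => ?_) (half_pos hW.pos) ?_
  · rw [cocompact_eq_atBot_atTop]
    refine Tendsto.sup ?_ ?_
    · simpa using (hφ.2.2.1.comp (tendsto_atBot_add_const_right _ h tendsto_id)).sub hφ.2.2.1
    · simpa using
        (hφ.2.2.2.1.comp (tendsto_atTop_add_const_right _ h tendsto_id)).sub hφ.2.2.2.1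
  · intro h h0 h1 x hx
    obtain ⟨y, hy, hyx⟩ := exists_ratio_hasDerivAt_eq_ratio_slope φ (deriv φ)
      (by linarith : x < x + h) hd.continuous.continuousOn (fun t _ => (hd t).hasDerivAt)
      (fun t => deriv W (φ t)) (fun t => deriv (deriv W) (φ t) * deriv φ t)
      (hdW.continuous.comp hd.continuous).continuousOn
      (fun t _ => (hdW (φ t)).hasDerivAt.comp t (hd t).hasDerivAt)
    refine ⟨deriv (deriv W) (φ y), (hR y ?_).le, ?_⟩
    · have h2 := abs_sub_abs_le_abs_sub x y
      have h3 : |x - y| ≤ 1 := abs_le.2 ⟨by linarith [hy.2], by linarith [hy.1]⟩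
      linarith
    · have hpos := hφ.2.2.2.2.2 y
      have : deriv W (φ (x + h)) - deriv W (φ x) =
          deriv (deriv W) (φ y) * (φ (x + h) - φ x) := by
        refine mul_right_cancel₀ hpos.ne' (hyx.trans ?_)
        ring
      simp [this]

lemma IsPhi.contDiff_deriv (hφ : IsPhi W φ) : ContDiff ℝ 3 (deriv φ) := ContDiff.deriv' hφ.1

lemma IsPhi.contDiff_deriv_two (hφ : IsPhi W φ) : ContDiff ℝ 2 (deriv (deriv φ)) :=
  ContDiff.deriv' hφ.contDiff_deriv

lemma IsPhi.hasDerivAt_comp (hφ : IsPhi W φ) {f : ℝ → ℝ} (hf : Differentiable ℝ f) (x : ℝ) :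
    HasDerivAt (fun x => f (φ x)) (deriv f (φ x) * deriv φ x) x :=
  (hf (φ x)).hasDerivAt.comp x (hφ.differentiable x).hasDerivAt

lemma IsPhi.quadDecay_deriv_comp (hW : AssumptionW W) (hφ : IsPhi W φ) {f : ℝ → ℝ}
    (hf : ContDiff ℝ 1 f) : QuadDecay (deriv fun x => f (φ x)) := by
  rw [funext fun x => (hφ.hasDerivAt_comp (hf.differentiable (by norm_num)) x).deriv]
  exact (hφ.quadDecay_deriv hW).bdd_mul (hφ.bdd_comp (hf.continuous_deriv le_rfl))

lemma IsPhi.halfLap_deriv (hW : AssumptionW W) (hφ : IsPhi W φ) (x : ℝ) :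
    halfLap (deriv φ) x = deriv (deriv W) (φ x) * deriv φ x + 0 := by
  have h1 := hasDerivAt_halfLap (hφ.1.of_le (by norm_num)) hφ.bddC2.2
    (hφ.quadDecay_deriv hW).bdd x
  rw [funext hφ.2.1] at h1
  rw [add_zero]
  exact h1.unique (hφ.hasDerivAt_comp (hW.contDiff_deriv.differentiable (by norm_num)) x)

lemma IsPhi.quadDecay_deriv_two (hW : AssumptionW W) (hφ : IsPhi W φ) :
    QuadDecay (deriv (deriv φ)) := by
  have h1 := hφ.quadDecay_deriv hW
  have hc2 := hW.contDiff_deriv_two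
  refine quadDecay_deriv_of_linear (G := fun _ => 0) ⟨hφ.contDiff_deriv.of_le (by norm_num), h1.bdd⟩
    h1.tendsto_zero
    ((hc2.differentiable (by norm_num)).comp hφ.differentiable)
    (differentiable_const 0) (hφ.halfLap_deriv hW) hW.pos (hφ.tendsto_deriv_two_comp hW)
    (hφ.quadDecay_deriv_comp hW (hc2.of_le (by norm_num))) ⟨0, fun x => by simp⟩

lemma IsPhi.hasDerivAt_deriv_comp (hφ : IsPhi W φ) {f : ℝ → ℝ} (hf : ContDiff ℝ 2 f) (x : ℝ) :
    HasDerivAt (deriv fun x => f (φ x))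
      (deriv (deriv f) (φ x) * deriv φ x * deriv φ x + deriv f (φ x) * deriv (deriv φ) x) x := by
  rw [funext fun x => (hφ.hasDerivAt_comp (hf.differentiable (by norm_num)) x).deriv]
  have hf' : ContDiff ℝ 1 (deriv f) := ContDiff.deriv' hf
  exact (hφ.hasDerivAt_comp (hf'.differentiable (by norm_num)) x).mul
    ((hφ.contDiff_deriv.differentiable (by norm_num)) x).hasDerivAt

lemma IsPhi.quadDecay_deriv_two_comp (hW : AssumptionW W) (hφ : IsPhi W φ) {f : ℝ → ℝ}
    (hf : ContDiff ℝ 2 f) : QuadDecay (deriv (deriv fun x => f (φ x))) := by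
  rw [funext fun x => (hφ.hasDerivAt_deriv_comp hf x).deriv]
  have hf' : ContDiff ℝ 1 (deriv f) := ContDiff.deriv' hf
  have h1 := hφ.quadDecay_deriv hW
  exact (h1.bdd_mul (h1.bdd_mul (hφ.bdd_comp (hf'.continuous_deriv le_rfl))).bdd).add
    ((hφ.quadDecay_deriv_two hW).bdd_mul (hφ.bdd_comp hf'.continuous))

lemma IsPhi.quadDecay_deriv_three (hW : AssumptionW W) (hφ : IsPhi W φ) :
    QuadDecay (deriv (deriv (deriv φ))) := by
  have h1 := hφ.quadDecay_deriv hW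
  have h2 := hφ.quadDecay_deriv_two hW
  have hc2 := hW.contDiff_deriv_two
  have hV : Differentiable ℝ fun x => deriv (deriv W) (φ x) :=
    (hc2.differentiable (by norm_num)).comp hφ.differentiable
  have hV1 := hφ.quadDecay_deriv_comp hW (hc2.of_le (by norm_num))
  have hV2 := hφ.quadDecay_deriv_two_comp hW hc2
  have hG : ∀ x, HasDerivAt
      (fun x => deriv (fun x => deriv (deriv W) (φ x)) x * deriv φ x + deriv (fun _ => (0:ℝ)) x)
      (deriv (deriv fun x => deriv (deriv W) (φ x)) x * deriv φ x +
        deriv (fun x => deriv (deriv W) (φ x)) x * deriv (deriv φ) x) x := by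
    intro x
    simp only [deriv_const, add_zero]
    exact (hφ.hasDerivAt_deriv_comp hc2 x).differentiableAt.hasDerivAt.mul
      ((hφ.contDiff_deriv.differentiable (by norm_num)) x).hasDerivAt
  refine quadDecay_deriv_of_linear ⟨hφ.contDiff_deriv_two, h2.bdd⟩ h2.tendsto_zero hV
    (fun x => (hG x).differentiableAt)
    (_root_.halfLap_deriv hφ.contDiff_deriv h1.bdd h2.bdd hV (differentiable_const 0)
      (hφ.halfLap_deriv hW)) hW.pos (hφ.tendsto_deriv_two_comp hW) hV1 ?_
  rw [funext fun x => (hG x).deriv]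
  exact (h1.bdd_mul hV2.bdd).add (h2.bdd_mul hV1.bdd)

lemma IsPhi.abs_sub_step_le_one (hφ : IsPhi W φ) (x : ℝ) : |φ x - step x| ≤ 1 := by
  obtain ⟨h1, h2⟩ := hφ.mem_Icc x
  obtain ⟨h3, h4⟩ := step_mem x
  exact abs_le.2 ⟨by linarith, by linarith⟩

/-- The layer approaches its limits at rate `1 / |x|`. -/
lemma IsPhi.quadDecay_sub_step_sq (hW : AssumptionW W) (hφ : IsPhi W φ) :
    QuadDecay (fun x => (φ x - step x) ^ 2) := by
  obtain ⟨K, hK0, hK⟩ := (hφ.quadDecay_deriv hW).exists_pos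
  have hmono : Monotone fun x => K * Real.arctan x - φ x := by
    have hd : ∀ x, HasDerivAt (fun x => K * Real.arctan x - φ x)
        (K * (1 / (1 + x ^ 2)) - deriv φ x) x := fun x =>
      ((Real.hasDerivAt_arctan x).const_mul K).sub (hφ.differentiable x).hasDerivAt
    refine monotone_of_deriv_nonneg (fun x => (hd x).differentiableAt) fun x => ?_
    rw [(hd x).deriv, mul_one_div]
    linarith [(abs_le.1 (hK x)).2]
  have htop : ∀ x, K * Real.arctan x - φ x ≤ K * (Real.pi / 2) - 1 := fun x =>
    hmono.ge_of_tendsto (((tendsto_nhds_of_tendsto_nhdsWithin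
      Real.tendsto_arctan_atTop).const_mul K).sub hφ.2.2.2.1) x
  have hbot : ∀ x, K * (-(Real.pi / 2)) - 0 ≤ K * Real.arctan x - φ x := fun x =>
    hmono.le_of_tendsto (((tendsto_nhds_of_tendsto_nhdsWithin
      Real.tendsto_arctan_atBot).const_mul K).sub hφ.2.2.1) x
  refine quadDecay_of_abs_le (M := 1) (C := K ^ 2) (fun x _ => ?_) fun x hx => ?_
  · rw [abs_pow]
    exact pow_le_one₀ (abs_nonneg _) (hφ.abs_sub_step_le_one x)
  · rw [abs_of_nonneg (sq_nonneg _), ← div_pow]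
    refine sq_le_sq' ?_ ?_ |>.trans (le_of_eq (by rw [div_pow, div_pow, sq_abs]))
      (b := (K / |x|) ^ 2) <;>
    rcases one_le_abs_cases hx with h | ⟨y, hy, rfl⟩
    · have h1 := htop x
      have h2 := mul_le_mul_of_nonneg_left
        (arctan_bounds (inv_pos.2 (by linarith : 0 < x))).2 hK0.le
      rw [Real.arctan_inv_of_pos (by linarith)] at h2
      rw [step_of_pos (by linarith), abs_of_pos (by linarith), div_eq_mul_inv]
      linarith
    · rw [step_of_neg (by linarith), abs_neg, abs_of_pos (by linarith)]
      have := (hφ.mem_Icc (-y)).1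
      have : 0 ≤ K / y := div_nonneg hK0.le (by linarith)
      linarith
    · rw [step_of_pos (by linarith), abs_of_pos (by linarith)]
      have := (hφ.mem_Icc x).2
      have : 0 ≤ K / x := div_nonneg hK0.le (by linarith)
      linarith
    · have h1 := hbot (-y)
      have h2 := mul_le_mul_of_nonneg_left
        (arctan_bounds (inv_pos.2 (by linarith : 0 < y))).2 hK0.le
      rw [Real.arctan_inv_of_pos (by linarith)] at h2
      rw [Real.arctan_neg] at h1
      rw [step_of_neg (by linarith), abs_neg, abs_of_pos (by linarith), div_eq_mul_inv]
      linarith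

lemma IsPhi.quadDecay_taylor (hW : AssumptionW W) (hφ : IsPhi W φ) {f : ℝ → ℝ}
    (hf : ContDiff ℝ 2 f) :
    QuadDecay (fun x => f (φ x) - f (step x) - deriv f (step x) * (φ x - step x)) := by
  obtain ⟨C, hC⟩ := exists_taylor_bound hf 0 1
  refine ((hφ.quadDecay_sub_step_sq hW).const_mul C).mono fun x => ?_
  exact (hC _ (step_mem x) _ (hφ.mem_Icc x)).trans (le_abs_self _)

/-- First-order expansion of the layer at infinity. -/
lemma IsPhi.quadDecay_expansion (hW : AssumptionW W) (hφ : IsPhi W φ) :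
    QuadDecay (fun x => φ x - step x + 1 / (deriv (deriv W) 0 * Real.pi) * conjPoisson x) := by
  set α := deriv (deriv W) 0 with hα
  have hα0 : 0 < α := hW.pos
  have hp := Real.pi_pos
  set κ := (α - 1) / (α * Real.pi) with hκ
  have hb1 := hφ.bddC2.sub bddC2_arctanLayer
  have hb2 := bddC2_conjPoisson.const_mul κ
  have hlim1 : Tendsto (fun x => φ x - arctanLayer x) (cocompact ℝ) (𝓝 0) := by
    rw [cocompact_eq_atBot_atTop]
    refine Tendsto.sup ?_ ?_
    · have := ((tendsto_nhds_of_tendsto_nhdsWithin Real.tendsto_arctan_atBot).const_mul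
        (1 / Real.pi)).const_add (1 / 2)
      have e : (0:ℝ) = 0 - (1 / 2 + 1 / Real.pi * -(Real.pi / 2)) := by
        field_simp
        norm_num
      rw [e]
      exact hφ.2.2.1.sub this
    · have := ((tendsto_nhds_of_tendsto_nhdsWithin Real.tendsto_arctan_atTop).const_mul
        (1 / Real.pi)).const_add (1 / 2)
      have e : (0:ℝ) = 1 - (1 / 2 + 1 / Real.pi * (Real.pi / 2)) := by
        field_simp
        norm_num
      rw [e]
      exact hφ.2.2.2.1.sub this
  have hlim : Tendsto (fun x => φ x - arctanLayer x - κ * conjPoisson x) (cocompact ℝ) (𝓝 0) := by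
    simpa using hlim1.sub (tendsto_conjPoisson.const_mul κ)
  have hT := hφ.quadDecay_taylor hW (f := deriv W) (hW.contDiff_deriv.of_le (by norm_num))
  have hu := quadDecay_of_coercive (hb1.sub hb2) hlim hα0 (V := fun _ => α) tendsto_const_nhds
    (((hT.add (quadDecay_arctanLayer.const_mul α)).add
      (quadDecay_halfLap_conjPoisson.const_mul (-κ))).mono fun x => le_of_eq (by
        rw [halfLap_sub hb1 hb2, halfLap_sub hφ.bddC2 bddC2_arctanLayer,
          halfLap_const_mul bddC2_conjPoisson, hφ.2.1, halfLap_arctanLayer, hW.deriv_step,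
          hW.deriv_two_step]
        congr 1
        rw [hκ, ← hα]
        field_simp
        ring))
  refine (hu.add quadDecay_arctanLayer).mono fun x => le_of_eq ?_
  congr 1
  rw [hκ]
  field_simp
  ring

end Layer

section Corrector

variable {W φ ψ : ℝ → ℝ} {L : ℝ}

lemma IsPsi.tendsto_zero (hψ : IsPsi W φ L ψ) : Tendsto ψ (cocompact ℝ) (𝓝 0) := by
  rw [cocompact_eq_atBot_atTop]
  exact hψ.2.2.1.sup hψ.2.2.2

lemma IsPsi.bddC2 (hψ : IsPsi W φ L ψ) : BddC2 ψ := by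
  refine ⟨hψ.1.of_le (by norm_num), ?_⟩
  have hc := hψ.1.continuous
  obtain ⟨R, hR⟩ := exists_forall_abs_lt
    (hψ.tendsto_zero.abs.eventually_lt_const (by norm_num : |(0:ℝ)| < 1))
  obtain ⟨M, hM⟩ := isCompact_Icc.exists_bound_of_continuousOn (s := Icc (-R) R) hc.continuousOn
  refine ⟨max M 1, fun x => ?_⟩
  rcases le_or_gt |x| R with h | h
  · exact (hM x (abs_le.1 h)).trans (le_max_left _ _)
  · exact (hR x h).le.trans (le_max_right _ _)

/-- The source term of the corrector equation. -/
def source (W φ : ℝ → ℝ) (L x : ℝ) : ℝ :=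
  L / deriv (deriv W) 0 * (deriv (deriv W) (φ x) - deriv (deriv W) 0) +
    L / (∫ y : ℝ, (deriv φ y) ^ 2) * deriv φ x

lemma IsPsi.halfLap_eq (hψ : IsPsi W φ L ψ) (x : ℝ) :
    halfLap ψ x = deriv (deriv W) (φ x) * ψ x + source W φ L x := by
  rw [hψ.2.1 x, source]
  ring

lemma IsPhi.differentiable_deriv_two_comp (hW : AssumptionW W) (hφ : IsPhi W φ) :
    Differentiable ℝ fun x => deriv (deriv W) (φ x) :=
  (hW.contDiff_deriv_two.differentiable (by norm_num)).comp hφ.differentiable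

lemma hasDerivAt_source (hW : AssumptionW W) (hφ : IsPhi W φ) (L x : ℝ) :
    HasDerivAt (source W φ L)
      (L / deriv (deriv W) 0 * deriv (fun x => deriv (deriv W) (φ x)) x +
        L / (∫ y : ℝ, (deriv φ y) ^ 2) * deriv (deriv φ) x) x :=
  (((hφ.differentiable_deriv_two_comp hW x).hasDerivAt.sub_const _).const_mul _).add
    (((hφ.contDiff_deriv.differentiable (by norm_num)) x).hasDerivAt.const_mul _)

lemma hasDerivAt_deriv_source (hW : AssumptionW W) (hφ : IsPhi W φ) (L x : ℝ) :
    HasDerivAt (deriv (source W φ L))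
      (L / deriv (deriv W) 0 * deriv (deriv fun x => deriv (deriv W) (φ x)) x +
        L / (∫ y : ℝ, (deriv φ y) ^ 2) * deriv (deriv (deriv φ)) x) x := by
  rw [funext fun x => (hasDerivAt_source hW hφ L x).deriv]
  exact ((hφ.hasDerivAt_deriv_comp
    hW.contDiff_deriv_two x).differentiableAt.hasDerivAt.const_mul _).add
    (((hφ.contDiff_deriv_two.differentiable (by norm_num)) x).hasDerivAt.const_mul _)

lemma quadDecay_deriv_source (hW : AssumptionW W) (hφ : IsPhi W φ) (L : ℝ) :
    QuadDecay (deriv (source W φ L)) := by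
  rw [funext fun x => (hasDerivAt_source hW hφ L x).deriv]
  exact ((hφ.quadDecay_deriv_comp hW (hW.contDiff_deriv_two.of_le (by norm_num))).const_mul _).add
    ((hφ.quadDecay_deriv_two hW).const_mul _)

lemma quadDecay_deriv_deriv_source (hW : AssumptionW W) (hφ : IsPhi W φ) (L : ℝ) :
    QuadDecay (deriv (deriv (source W φ L))) := by
  rw [funext fun x => (hasDerivAt_deriv_source hW hφ L x).deriv]
  exact ((hφ.quadDecay_deriv_two_comp hW hW.contDiff_deriv_two).const_mul _).add
    ((hφ.quadDecay_deriv_three hW).const_mul _)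

lemma IsPsi.quadDecay_deriv (hW : AssumptionW W) (hφ : IsPhi W φ) (hψ : IsPsi W φ L ψ) :
    QuadDecay (deriv ψ) :=
  quadDecay_deriv_of_linear hψ.bddC2 hψ.tendsto_zero (hφ.differentiable_deriv_two_comp hW)
    (fun x => (hasDerivAt_source hW hφ L x).differentiableAt) hψ.halfLap_eq hW.pos
    (hφ.tendsto_deriv_two_comp hW)
    (hφ.quadDecay_deriv_comp hW (hW.contDiff_deriv_two.of_le (by norm_num)))
    (quadDecay_deriv_source hW hφ L)

lemma IsPsi.quadDecay_deriv_two (hW : AssumptionW W) (hφ : IsPhi W φ) (hψ : IsPsi W φ L ψ) :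
    QuadDecay (deriv (deriv ψ)) := by
  have h1 := hψ.quadDecay_deriv hW hφ
  have hV := hφ.differentiable_deriv_two_comp hW
  have hV1 := hφ.quadDecay_deriv_comp hW (hW.contDiff_deriv_two.of_le (by norm_num))
  have hG : ∀ x, HasDerivAt
      (fun x => deriv (fun x => deriv (deriv W) (φ x)) x * ψ x + deriv (source W φ L) x)
      (deriv (deriv fun x => deriv (deriv W) (φ x)) x * ψ x +
        deriv (fun x => deriv (deriv W) (φ x)) x * deriv ψ x +
        deriv (deriv (source W φ L)) x) x := fun x =>
    ((hφ.hasDerivAt_deriv_comp hW.contDiff_deriv_two x).differentiableAt.hasDerivAt.mul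
      (hψ.bddC2.differentiable x).hasDerivAt).add
      (hasDerivAt_deriv_source hW hφ L x).differentiableAt.hasDerivAt
  refine quadDecay_deriv_of_linear ⟨ContDiff.deriv' hψ.1, h1.bdd⟩ h1.tendsto_zero hV
    (fun x => (hG x).differentiableAt)
    (halfLap_deriv hψ.1 hψ.bddC2.2 h1.bdd hV
      (fun x => (hasDerivAt_source hW hφ L x).differentiableAt) hψ.halfLap_eq)
    hW.pos (hφ.tendsto_deriv_two_comp hW) hV1 ?_
  rw [funext fun x => (hG x).deriv]
  refine (QuadDecay.add ?_ (h1.bdd_mul hV1.bdd)).add (quadDecay_deriv_deriv_source hW hφ L)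
  refine ((hφ.quadDecay_deriv_two_comp hW hW.contDiff_deriv_two).bdd_mul hψ.bddC2.2).mono
    fun x => le_of_eq ?_
  rw [mul_comm]

/-- First-order expansion of the corrector at infinity. -/
lemma IsPsi.quadDecay_expansion (hW : AssumptionW W) (hφ : IsPhi W φ) (hψ : IsPsi W φ L ψ) :
    QuadDecay (fun x => ψ x - L * deriv (deriv (deriv W)) 0 /
      (deriv (deriv W) 0 ^ 3 * Real.pi) * conjPoisson x) := by
  have hα := hW.pos
  have hp := Real.pi_pos
  have hφe := hφ.quadDecay_expansion hW
  have hT := hφ.quadDecay_taylor hW hW.contDiff_deriv_two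
  simp only [hW.deriv_two_step, hW.deriv_three_step] at hT
  have hsp := (hφ.quadDecay_sub_step_sq hW).mul_of_sq quadDecay_conjPoisson_sq
  have hTp := hT.bdd_mul bddC2_conjPoisson.2
  have hφ1 := hφ.quadDecay_deriv hW
  set α := deriv (deriv W) 0
  set w := deriv (deriv (deriv W)) 0
  set K₂ := L * w / (α ^ 3 * Real.pi) with hK₂
  have hlim : Tendsto (fun x => ψ x - K₂ * conjPoisson x) (cocompact ℝ) (𝓝 0) := by
    simpa using hψ.tendsto_zero.sub (tendsto_conjPoisson.const_mul K₂)
  refine quadDecay_of_coercive (hψ.bddC2.sub (bddC2_conjPoisson.const_mul K₂)) hlim hα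
    (hφ.tendsto_deriv_two_comp hW) ?_
  refine ((((((hTp.const_mul K₂).add (hsp.const_mul (K₂ * w))).add (hT.const_mul (L / α))).add
    (hφe.const_mul (L / α * w))).add
    (hφ1.const_mul (L / (∫ y : ℝ, (deriv φ y) ^ 2)))).add
    (quadDecay_halfLap_conjPoisson.const_mul (-K₂))).mono fun x => le_of_eq ?_
  rw [halfLap_sub hψ.bddC2 (bddC2_conjPoisson.const_mul K₂), halfLap_const_mul bddC2_conjPoisson,
    hψ.2.1]
  congr 1
  have e : α * K₂ = L / α * w * (1 / (α * Real.pi)) := by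
    rw [hK₂]
    field_simp
  linear_combination (conjPoisson x) * e

end Corrector

/-- **Behavior of `ψ` at infinity** (Lemma 6.4).  Assume (W) with `N = 1` and `g ≡ 1/π`,
let `φ` be the phase transition and, for `L ∈ ℝ`, let `ψ` be the corrector.  Then there
exist `K2 ∈ ℝ` and `K3 > 0` (depending on `L`) with `|ψ(x) − K2/x| ≤ K3/x²` for `|x| ≥ 1`
and, for all `x`, `|ψ'(x)| ≤ K3/(1+x²)` and `|ψ''(x)| ≤ K3/(1+x²)`. -/
theorem psi_behavior (W : ℝ → ℝ) (hW : AssumptionW W) (φ : ℝ → ℝ) (hφ : IsPhi W φ)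
    (L : ℝ) (ψ : ℝ → ℝ) (hψ : IsPsi W φ L ψ) :
    ∃ K2 : ℝ, ∃ K3 > (0:ℝ),
      (∀ x : ℝ, 1 ≤ |x| → |ψ x - K2 / x| ≤ K3 / x ^ 2) ∧
      (∀ x : ℝ, -(K3 / (1 + x ^ 2)) ≤ deriv ψ x ∧ deriv ψ x ≤ K3 / (1 + x ^ 2)) ∧
      (∀ x : ℝ, -(K3 / (1 + x ^ 2)) ≤ iteratedDeriv 2 ψ x ∧
        iteratedDeriv 2 ψ x ≤ K3 / (1 + x ^ 2)) := by
  obtain ⟨K, hK0, hK⟩ := (hψ.quadDecay_expansion hW hφ).exists_pos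
  obtain ⟨K', hK'0, hK'⟩ := (hψ.quadDecay_deriv hW hφ).exists_pos
  obtain ⟨K'', hK''0, hK''⟩ := (hψ.quadDecay_deriv_two hW hφ).exists_pos
  set K₂ := L * deriv (deriv (deriv W)) 0 / (deriv (deriv W) 0 ^ 3 * Real.pi)
  have h0 := abs_nonneg K₂
  refine ⟨K₂, K + |K₂| + K' + K'', by positivity, fun x hx => ?_, fun x => ?_, fun x => ?_⟩
  · have hx0 : x ≠ 0 := by rintro rfl; norm_num at hx
    have h1 : |K₂ * (conjPoisson x - 1 / x)| ≤ |K₂| * (1 / x ^ 2) := by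
      rw [abs_mul]
      exact mul_le_mul_of_nonneg_left (conjPoisson_sub_inv_le hx) h0
    have h2 : K / (1 + x ^ 2) ≤ K / x ^ 2 :=
      div_le_div_of_nonneg_left hK0.le (by positivity) (by linarith)
    have e : ψ x - K₂ / x = (ψ x - K₂ * conjPoisson x) + K₂ * (conjPoisson x - 1 / x) := by ring
    rw [e]
    calc _ ≤ K / x ^ 2 + |K₂| * (1 / x ^ 2) :=
          (abs_add_le _ _).trans (add_le_add ((hK x).trans h2) h1)
      _ = (K + |K₂|) / x ^ 2 := by ring
      _ ≤ _ := div_le_div_of_nonneg_right (by linarith) (by positivity)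
  · exact abs_le.1 ((hK' x).trans (div_le_div_of_nonneg_right (by linarith) (by positivity)))
  · have h2 : iteratedDeriv 2 ψ = deriv (deriv ψ) := by
      rw [iteratedDeriv_succ, iteratedDeriv_one]
    rw [h2]
    exact abs_le.1 ((hK'' x).trans (div_le_div_of_nonneg_right (by linarith) (by positivity)))
end
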